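/- Let (M, 𝓜, ν) be a finite measure space and μ a finite signed measure on (M, 𝓜). Then there exists a measurable set M⁺ ∈ 𝓜 such that μ(M⁺) = max over measurable S of μ(S) (i.e., μ(S) ≤ μ(M⁺) for all measurable S), and moreover for every measurable set T ∈ 𝓜 with μ(T) = μ(M⁺), one has ν(T) ≤ ν(M⁺). -/

import Mathlib

open MeasureTheory

/-- A measurable set maximizes a signed measure if and only if it is the positive part of a
Hahn decomposition. -/
theorem signedMeasure_le_iff_positive_negative {M : Type*} [MeasurableSpace M]
    (μ : SignedMeasure M) {P : Set M} (hP : MeasurableSet P) :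
    (∀ S : Set M, MeasurableSet S → μ S ≤ μ P) ↔
      VectorMeasure.restrict 0 P ≤ μ.restrict P ∧
        μ.restrict Pᶜ ≤ VectorMeasure.restrict 0 Pᶜ := by
  rw [VectorMeasure.restrict_le_restrict_iff _ _ hP,
    VectorMeasure.restrict_le_restrict_iff _ _ hP.compl]
  constructor
  · intro h
    refine ⟨fun A hA hAP => ?_, fun A hA hAP => ?_⟩
    · have h₁ := VectorMeasure.of_add_of_sdiff (v := μ) hA hP hAP
      have h₂ := h (P \ A) (hP.diff hA)
      simp only [FunLike.coe_zero, Pi.zero_apply]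
      linarith
    · have h₁ := VectorMeasure.of_union (v := μ) (Set.disjoint_left.2 fun x hx hxA => hAP hxA hx)
        hP hA
      have h₂ := h (P ∪ A) (hP.union hA)
      simp only [FunLike.coe_zero, Pi.zero_apply]
      linarith
  · rintro ⟨hpos, hneg⟩ S hS
    have h₁ := VectorMeasure.of_add_of_sdiff (v := μ) (hS.inter hP) hS Set.inter_subset_left
    have h₂ := VectorMeasure.of_add_of_sdiff (v := μ) (hS.inter hP) hP Set.inter_subset_right
    have h₃ := hneg (hS.diff (hS.inter hP)) fun x hx hxP => hx.2 ⟨hx.1, hxP⟩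
    have h₄ := hpos (hP.diff (hS.inter hP)) Set.sdiff_subset
    simp only [FunLike.coe_zero, Pi.zero_apply] at h₃ h₄
    linarith

theorem signedMeasure_max_attained_with_tie_breaking
    {M : Type*} [MeasurableSpace M] (ν : Measure M) [IsFiniteMeasure ν]
    (μ : SignedMeasure M) :
    ∃ Mplus : Set M, MeasurableSet Mplus ∧
      (∀ S : Set M, MeasurableSet S → μ S ≤ μ Mplus) ∧
      (∀ T : Set M, MeasurableSet T → μ T = μ Mplus → ν T ≤ ν Mplus) := by
  let maximizers : Set (Set M) :=
    {P | MeasurableSet P ∧ ∀ S : Set M, MeasurableSet S → μ S ≤ μ P}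
  obtain ⟨P, hP, hpos, hneg⟩ := SignedMeasure.exists_compl_positive_negative μ
  have hne : (ν '' maximizers).Nonempty :=
    ⟨ν P, P, ⟨hP, (signedMeasure_le_iff_positive_negative μ hP).2 ⟨hpos, hneg⟩⟩, rfl⟩
  obtain ⟨u, -, hu, hmem⟩ := exists_seq_tendsto_sSup hne (OrderTop.bddAbove _)
  choose B hB hBu using hmem
  have hBsign n := (signedMeasure_le_iff_positive_negative μ (hB n).1).1 (hB n).2
  have hU : MeasurableSet (⋃ n, B n) := .iUnion fun n => (hB n).1
  have hUmax := (signedMeasure_le_iff_positive_negative μ hU).2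
    ⟨VectorMeasure.restrict_le_restrict_iUnion _ _ (fun n => (hB n).1) fun n => (hBsign n).1,
      VectorMeasure.restrict_le_zero_subset _ (hB 0).1.compl
        (Set.compl_subset_compl.2 (Set.subset_iUnion B 0)) (hBsign 0).2⟩
  refine ⟨⋃ n, B n, hU, hUmax, fun T hT hTU => ?_⟩
  calc
    ν T ≤ sSup (ν '' maximizers) := le_sSup ⟨T, ⟨hT, fun S hS => hTU ▸ hUmax S hS⟩, rfl⟩
    _ ≤ ν (⋃ n, B n) :=
      le_of_tendsto' hu fun n => hBu n ▸ measure_mono (Set.subset_iUnion B n)
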